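/- Sharp decay estimate for the damped Klein–Gordon equation on hyperboloids: Let c > 0, 2 ≤ s₀ ≤ s₁, and let v, h, f be smooth functions on K_{[s₀,s₁]}, with v vanishing on a neighborhood of {r = t−1}, satisfying □v − h∂_t v + c²v = f. Assume |(t/s)h| ≤ c everywhere on K_{[s₀,s₁]}, and that there exists a function S on K_{[s₀,s₁]} such that S + (t/s)h ≤ 0 pointwise and, for every (t,x) ∈ K_{[s₀,s₁]}, ∫_{λ₀}^{s₁} |S(γ_{t,x}(λ))| dλ ≤ C_S for a constant C_S, where γ_{t,x}(λ) = (λt/s, λx/s) and λ₀ = s₀ if 0 ≤ r/t ≤ (s₀²−1)/(s₀²+1) and λ₀ = √((t+r)/(t−r)) if (s₀²−1)/(s₀²+1) ≤ r/t < 1. Then for every η ∈ ℝ there is a constant K depending only on c, C_S, s₀, η such that for all (t,x) ∈ K_{[s₀,s₁]} (with s = √(t²−r²)): (s/t)^η s^{3/2} ( |v(t,x)| + (s/t) max_{α=0,…,3}|∂_α v(t,x)| ) ≤ K · V(t,x), where V(t,x) = (s/t)^η sup_{H_{s₀}}(|v| + max_α|∂_α v|) + (s/t)^η s^{1/2} |v|₁(t,x)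 + (s/t)^η ∫_{λ₀}^{s} | R[h,v] + τ^{3/2} f |(γ_{t,x}(τ)) dτ in the region 0 ≤ r/t ≤ (s₀²−1)/(s₀²+1), and V(t,x) = (s/t)^η s^{1/2} |v|₁(t,x) + (s/t)^η ∫_{λ₀}^{s} | R[h,v] + τ^{3/2} f |(γ_{t,x}(τ)) dτ in the region (s₀²−1)/(s₀²+1) ≤ r/t < 1. Here |v|₁(t,x) = max of |v| and |Zv| over Z ∈ {∂_t, ∂_1, ∂_2, ∂_3, L_1, L_2, L_3}, and R[h,v] = s^{3/2}( Σ_{a,b}(x^a x^b/s²)∂̄_a∂̄_b v + Σ_a ∂̄_a∂̄_a v + Σ_a (3x^a/s²)∂̄_a v + (3/(4s²))v ) − (3/2) s^{1/2} h v − Σ_a s^{1/2}(x^a/s) h L_a v. -/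

import Mathlib

noncomputable section

/-- Spatial radius `r = |x|` of a space-time point `p = (t,x)`. -/
def rad (p : Fin 4 → ℝ) : ℝ := Real.sqrt (∑ a : Fin 3, (p a.succ) ^ 2)

/-- Partial derivative in the `i`-th coordinate direction (`0` is time). -/
def pd (i : Fin 4) (u : (Fin 4 → ℝ) → ℝ) : (Fin 4 → ℝ) → ℝ :=
  fun p => fderiv ℝ u p (Pi.single i 1)

/-- The flat wave operator `□u = ∂_t∂_t u - Σ_a ∂_a∂_a u`. -/
def box (u : (Fin 4 → ℝ) → ℝ) : (Fin 4 → ℝ) → ℝ :=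
  fun p => pd 0 (pd 0 u) p - ∑ a : Fin 3, pd a.succ (pd a.succ u) p

/-- The hyperboloidal time `s = √(t² - r²)`. -/
def sfun (p : Fin 4 → ℝ) : ℝ := Real.sqrt ((p 0) ^ 2 - (rad p) ^ 2)

/-- `∂̄_s v = (s/t) ∂_t v`, the `s`-coordinate vector field of hyperbolic coordinates. -/
def dbs (v : (Fin 4 → ℝ) → ℝ) : (Fin 4 → ℝ) → ℝ :=
  fun p => (sfun p / p 0) * pd 0 v p

/-- `∂̄_a v = (x^a/t) ∂_t v + ∂_a v`, the spatial vector fields of hyperbolic coordinates. -/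
def dba (a : Fin 3) (v : (Fin 4 → ℝ) → ℝ) : (Fin 4 → ℝ) → ℝ :=
  fun p => (p a.succ / p 0) * pd 0 v p + pd a.succ v p

open MeasureTheory

/-- The region `K_{[s₀,s₁]} = {(t,x) : s₀² ≤ t² - r² ≤ s₁², r < t - 1}`. -/
def Kset (s₀ s₁ : ℝ) : Set (Fin 4 → ℝ) :=
  {p | s₀ ^ 2 ≤ (p 0) ^ 2 - (rad p) ^ 2 ∧ (p 0) ^ 2 - (rad p) ^ 2 ≤ s₁ ^ 2 ∧ rad p < p 0 - 1}

/-- The point of the hyperboloid `H_s` above `x ∈ ℝ³`. -/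
def hpt (s : ℝ) (x : Fin 3 → ℝ) : Fin 4 → ℝ :=
  Fin.cons (Real.sqrt (s ^ 2 + ∑ a : Fin 3, (x a) ^ 2)) x

/-- `v` vanishes on a neighborhood of the boundary `{r = t - 1}`. -/
def vanishNearBdry (u : (Fin 4 → ℝ) → ℝ) : Prop :=
  ∃ δ > 0, ∀ p : Fin 4 → ℝ, p 0 - 1 - δ ≤ rad p → u p = 0

/-- The Lorentz boost `L_a = x^a ∂_t + t ∂_a`. -/
def Lop (a : Fin 3) (u : (Fin 4 → ℝ) → ℝ) : (Fin 4 → ℝ) → ℝ :=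
  fun p => p a.succ * pd 0 u p + p 0 * pd a.succ u p

/-- The integral curve `γ_{t,x}(λ) = (λt/s, λx/s)` through `p = (t,x)`. -/
def ray (p : Fin 4 → ℝ) (lam : ℝ) : Fin 4 → ℝ :=
  fun i => (lam / sfun p) * p i

/-- The lower integration bound `λ₀(t,x)`. -/
def lam0 (s₀ : ℝ) (p : Fin 4 → ℝ) : ℝ :=
  if rad p / p 0 < (s₀ ^ 2 - 1) / (s₀ ^ 2 + 1) then s₀
  else Real.sqrt ((p 0 + rad p) / (p 0 - rad p))

/-- `|v|₁ = max(|v|, max_Z |Zv|)` over `Z ∈ {∂_t, ∂_1, ∂_2, ∂_3, L_1, L_2, L_3}`. -/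
def vone (v : (Fin 4 → ℝ) → ℝ) (p : Fin 4 → ℝ) : ℝ :=
  |v p| ⊔ ((⨆ α : Fin 4, |pd α v p|) ⊔ ⨆ a : Fin 3, |Lop a v p|)

/-- The remainder `R[h,v]` as a function of the space-time point. -/
def Rfun (h v : (Fin 4 → ℝ) → ℝ) : (Fin 4 → ℝ) → ℝ :=
  fun q => (sfun q) ^ ((3:ℝ)/2) *
      ((∑ a : Fin 3, ∑ b : Fin 3, (q a.succ * q b.succ / (sfun q) ^ 2) * dba a (dba b v) q)
        + (∑ a : Fin 3, dba a (dba a v) q)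
        + (∑ a : Fin 3, (3 * q a.succ / (sfun q) ^ 2) * dba a v q)
        + (3 / (4 * (sfun q) ^ 2)) * v q)
    - (3 / 2) * (sfun q) ^ ((1:ℝ)/2) * h q * v q
    - ∑ a : Fin 3, (sfun q) ^ ((1:ℝ)/2) * (q a.succ / sfun q) * h q * Lop a v q

/-- The majorant `V(t,x)`, defined by distinguishing the regions near and far
from the light cone. -/
def Vfun (s₀ η : ℝ) (h v f : (Fin 4 → ℝ) → ℝ) (p : Fin 4 → ℝ) : ℝ :=
  (if rad p / p 0 < (s₀ ^ 2 - 1) / (s₀ ^ 2 + 1) then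
      (sfun p / p 0) ^ η *
        ⨆ x : Fin 3 → ℝ, (|v (hpt s₀ x)| + ⨆ α : Fin 4, |pd α v (hpt s₀ x)|)
    else 0)
  + (sfun p / p 0) ^ η * (sfun p) ^ ((1:ℝ)/2) * vone v p
  + (sfun p / p 0) ^ η *
      ∫ τ in (lam0 s₀ p)..(sfun p),
        |Rfun h v (ray p τ) + τ ^ ((3:ℝ)/2) * f (ray p τ)|

theorem pd_contDiff {u : (Fin 4 → ℝ) → ℝ} (hu : ContDiff ℝ (⊤ : ℕ∞) u) (i : Fin 4) :
    ContDiff ℝ (⊤ : ℕ∞) (pd i u) := by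
  have h : ContDiff ℝ (⊤ : ℕ∞) (fderiv ℝ u) := hu.fderiv_right (by simp)
  exact h.clm_apply contDiff_const

theorem pd_comm {u : (Fin 4 → ℝ) → ℝ} (hu : ContDiff ℝ (⊤ : ℕ∞) u) (i j : Fin 4)
    (q : Fin 4 → ℝ) : pd i (pd j u) q = pd j (pd i u) q := by
  have hd : DifferentiableAt ℝ (fderiv ℝ u) q :=
    ((hu.fderiv_right (m := 1) (by norm_cast)).differentiable one_ne_zero) q
  have hs : IsSymmSndFDerivAt ℝ u q :=
    (hu.of_le (m := 2) (by norm_cast)).contDiffAt.isSymmSndFDerivAt (by simp)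
  have key (k l : Fin 4) : pd k (pd l u) q =
      fderiv ℝ (fderiv ℝ u) q (Pi.single k 1) (Pi.single l 1) := by
    unfold pd
    rw [fderiv_clm_apply hd (differentiableAt_const _)]
    simp
  rw [key, key]
  exact hs _ _

theorem fderiv_eq_sum_pd (u : (Fin 4 → ℝ) → ℝ) (q n : Fin 4 → ℝ) :
    fderiv ℝ u q n = ∑ i, n i * pd i u q := by
  conv_lhs => rw [← Finset.univ_sum_single n, map_sum]
  refine Finset.sum_congr rfl fun i _ => ?_
  have : (Pi.single i (n i) : Fin 4 → ℝ) = n i • Pi.single i 1 := by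
    rw [← Pi.single_smul]; simp
  rw [this, map_smul, smul_eq_mul, pd]

theorem hasDerivAt_comp_ray {u : (Fin 4 → ℝ) → ℝ} (hu : ContDiff ℝ (⊤ : ℕ∞) u)
    (p : Fin 4 → ℝ) (lam : ℝ) :
    HasDerivAt (fun l => u (ray p l)) (∑ i, p i / sfun p * pd i u (ray p lam)) lam := by
  have hr : HasDerivAt (ray p) (fun i => p i / sfun p) lam := by
    rw [hasDerivAt_pi]
    intro i
    have := ((hasDerivAt_id lam).div_const (sfun p)).mul_const (p i)
    simp only [id] at this
    rwa [one_div_mul_eq_div] at this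
  have := ((hu.differentiable (by simp)) (ray p lam)).hasFDerivAt.comp_hasDerivAt lam hr
  rwa [fderiv_eq_sum_pd] at this

theorem pd_dba {v : (Fin 4 → ℝ) → ℝ} (hv : ContDiff ℝ (⊤ : ℕ∞) v) (i : Fin 4) (b : Fin 3)
    {q : Fin 4 → ℝ} (hq : q 0 ≠ 0) :
    pd i (dba b v) q =
      ((if b.succ = i then 1 else 0) / q 0 - q b.succ * (if 0 = i then 1 else 0) / q 0 ^ 2)
          * pd 0 v q
        + q b.succ / q 0 * pd i (pd 0 v) q + pd i (pd b.succ v) q := by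
  have h0 (k : Fin 4) : HasFDerivAt (pd k v) (fderiv ℝ (pd k v) q) q :=
    ((pd_contDiff hv k).differentiable (by simp) q).hasFDerivAt
  have hx (k : Fin 4) : HasFDerivAt (fun p : Fin 4 → ℝ => p k)
      (ContinuousLinearMap.proj (R := ℝ) (φ := fun _ : Fin 4 => ℝ) k) q :=
    (ContinuousLinearMap.proj (R := ℝ) (φ := fun _ : Fin 4 => ℝ) k).hasFDerivAt
  have h := (((hx b.succ).mul ((hasDerivAt_inv hq).comp_hasFDerivAt q (hx 0))).mul (h0 0)).add
    (h0 b.succ)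
  have he : fderiv ℝ (dba b v) q = _ := h.fderiv
  rw [pd, he]
  simp only [pd, add_apply, smul_apply,
    ContinuousLinearMap.proj_apply, smul_eq_mul, Pi.single_apply, Pi.mul_apply, Function.comp]
  field_simp
  ring

theorem pd_zero_dba {v : (Fin 4 → ℝ) → ℝ} (hv : ContDiff ℝ (⊤ : ℕ∞) v) (b : Fin 3)
    {q : Fin 4 → ℝ} (hq : q 0 ≠ 0) :
    pd 0 (dba b v) q = -(q b.succ / q 0 ^ 2) * pd 0 v q
        + q b.succ / q 0 * pd 0 (pd 0 v) q + pd 0 (pd b.succ v) q := by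
  simp [pd_dba hv 0 b hq]

theorem pd_succ_dba {v : (Fin 4 → ℝ) → ℝ} (hv : ContDiff ℝ (⊤ : ℕ∞) v) (a b : Fin 3)
    {q : Fin 4 → ℝ} (hq : q 0 ≠ 0) :
    pd a.succ (dba b v) q = (if b = a then 1 else 0) / q 0 * pd 0 v q
        + q b.succ / q 0 * pd a.succ (pd 0 v) q + pd a.succ (pd b.succ v) q := by
  simp [pd_dba hv a.succ b hq, (Fin.succ_ne_zero a).symm]

theorem sfun_sq {q : Fin 4 → ℝ} (h : 0 < sfun q) :
    sfun q ^ 2 = q 0 ^ 2 - ∑ a : Fin 3, q a.succ ^ 2 := by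
  have h1 := Real.sqrt_pos.1 h
  rw [sfun, Real.sq_sqrt h1.le, rad, Real.sq_sqrt (Finset.sum_nonneg fun a _ => sq_nonneg _)]

/-- The wave operator minus its radial part, expressed in the hyperboloidal frame. -/
theorem second_order_decomposition {v : (Fin 4 → ℝ) → ℝ} (hv : ContDiff ℝ (⊤ : ℕ∞) v)
    {q : Fin 4 → ℝ} (hs : 0 < sfun q) (ht : 0 < q 0) :
    (∑ i, ∑ j, q i * q j / sfun q ^ 2 * pd i (pd j v) q)
        + 3 * ∑ i, q i / sfun q ^ 2 * pd i v q - box v q =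
      (∑ a : Fin 3, ∑ b : Fin 3, (q a.succ * q b.succ / (sfun q) ^ 2) * dba a (dba b v) q)
        + (∑ a : Fin 3, dba a (dba a v) q)
        + (∑ a : Fin 3, (3 * q a.succ / (sfun q) ^ 2) * dba a v q) := by
  have e2 (a b : Fin 3) : dba a (dba b v) q = q a.succ / q 0 * pd 0 (dba b v) q
      + pd a.succ (dba b v) q := rfl
  have e1 (a : Fin 3) : dba a v q = q a.succ / q 0 * pd 0 v q + pd a.succ v q := rfl
  have hD := sfun_sq hs
  have hDne : sfun q ^ 2 ≠ 0 := by positivity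
  have ht' := ht.ne'
  simp only [e2, e1, pd_zero_dba hv _ ht', pd_succ_dba hv _ _ ht', box]
  have c01 := pd_comm hv 1 0 q
  have c02 := pd_comm hv 2 0 q
  have c03 := pd_comm hv 3 0 q
  have c12 := pd_comm hv 2 1 q
  have c13 := pd_comm hv 3 1 q
  have c23 := pd_comm hv 3 2 q
  generalize sfun q ^ 2 = D at hD hDne ⊢
  simp only [Fin.sum_univ_succ, Fin.succ_zero_eq_one, Fin.succ_one_eq_two,
    Finset.univ_eq_empty, Finset.sum_empty, show Fin.succ (2 : Fin 3) = 3 from rfl] at hD ⊢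
  simp only [c01, c02, c03, c12, c13, c23, reduceIte, Fin.reduceEq, add_zero]
  field_simp
  rw [hD]
  ring

theorem rpow_three_halves {l : ℝ} (hl : 0 < l) : l ^ ((3:ℝ)/2) = l * l ^ ((1:ℝ)/2) := by
  rw [show (3:ℝ)/2 = 1 + 1/2 by norm_num, Real.rpow_add hl, Real.rpow_one]

theorem sum_mul_Lop (v : (Fin 4 → ℝ) → ℝ) {q : Fin 4 → ℝ} (hs : 0 < sfun q) :
    ∑ a : Fin 3, q a.succ * Lop a v q =
      q 0 * ∑ i, q i * pd i v q - sfun q ^ 2 * pd 0 v q := by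
  rw [sfun_sq hs]
  simp only [Lop, Fin.sum_univ_succ, Finset.univ_eq_empty, Finset.sum_empty]
  ring

theorem klein_gordon_radial {v h f : (Fin 4 → ℝ) → ℝ} (hv : ContDiff ℝ (⊤ : ℕ∞) v) {c : ℝ}
    {q : Fin 4 → ℝ} (hs : 0 < sfun q) (ht : 0 < q 0)
    (heq : box v q - h q * pd 0 v q + c ^ 2 * v q = f q) :
    sfun q ^ ((3:ℝ)/2) * ((∑ i, ∑ j, q i * q j / sfun q ^ 2 * pd i (pd j v) q)
        + 3 * (∑ i, q i / sfun q ^ 2 * pd i v q) + 3 / (4 * sfun q ^ 2) * v q + c ^ 2 * v q) =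
      Rfun h v q + sfun q ^ ((3:ℝ)/2) * f q
        + q 0 / sfun q * h q * (sfun q ^ ((3:ℝ)/2) * (∑ i, q i / sfun q * pd i v q)
          + 3 / 2 * sfun q ^ ((1:ℝ)/2) * v q)
        - 3 / 2 * (1 - sfun q / q 0) * (q 0 / sfun q * h q) * sfun q ^ ((1:ℝ)/2) * v q := by
  have hL := sum_mul_Lop v hs
  have hL' : ∑ a : Fin 3, sfun q ^ ((1:ℝ)/2) * (q a.succ / sfun q) * h q * Lop a v q =
      sfun q ^ ((1:ℝ)/2) / sfun q * h q * ∑ a : Fin 3, q a.succ * Lop a v q := by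
    rw [Finset.mul_sum]
    exact Finset.sum_congr rfl fun a _ => by ring
  have hU : ∑ i, q i / sfun q * pd i v q = (∑ i, q i * pd i v q) / sfun q := by
    rw [Finset.sum_div]
    exact Finset.sum_congr rfl fun a _ => by ring
  rw [Rfun, ← second_order_decomposition hv hs ht, hL', hL, hU, ← heq, rpow_three_halves hs]
  field_simp
  ring

/-- A damped oscillator whose friction `g` is bounded above by an integrable function, with the
lower-order perturbation `κ g w / l` of the potential: the energy grows by at most a factor
controlled by `∫ |B|`. -/
theorem sqrt_energy_le {a b c κ : ℝ} (hc : 0 < c) (ha : 2 ≤ a) (hab : a ≤ b)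
    (hκ0 : 0 ≤ κ) (hκ1 : κ ≤ 1) {w w1 w2 g B F : ℝ → ℝ}
    (hw : ∀ l, 0 < l → HasDerivAt w (w1 l) l) (hw1 : ∀ l, 0 < l → HasDerivAt w1 (w2 l) l)
    (hF : ContinuousOn F (Set.Ioi 0)) (hB : Continuous B)
    (heq : ∀ l ∈ Set.Ioo a b, w2 l + c ^ 2 * w l = F l + g l * w1 l - 3 / 2 * κ * g l * w l / l)
    (hg : ∀ l ∈ Set.Ioo a b, |g l| ≤ c) (hgB : ∀ l ∈ Set.Ioo a b, g l ≤ |B l|) :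
    √(w1 b ^ 2 + c ^ 2 * w b ^ 2) ≤
      Real.exp ((2 + 1 / c ^ 2) * (∫ l in a..b, |B l|) + 1 / c * (1 / a - 1 / b)) *
        (√(w1 a ^ 2 + c ^ 2 * w a ^ 2) + ∫ l in a..b, |F l|) := by
  have ha0 : 0 < a := by linarith
  set E : ℝ → ℝ := fun l => w1 l ^ 2 + c ^ 2 * w l ^ 2 with hE
  have hE0 (l : ℝ) : 0 ≤ E l := by positivity
  set Φ : ℝ → ℝ := fun l =>
    (2 + 1 / c ^ 2) * (∫ τ in a..l, |B τ|) + 1 / c * (1 / a - 1 / l) with hΦ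
  have hFa : ContinuousOn (fun l => |F l|) (Set.Ioi 0) := hF.abs
  have hdE (l : ℝ) (hl : 0 < l) :
      HasDerivAt E (2 * w1 l * w2 l + c ^ 2 * (2 * w l * w1 l)) l := by
    refine HasDerivAt.congr_deriv (f := E)
      (((hw1 l hl).pow 2).add (((hw l hl).pow 2).const_mul (c ^ 2))) ?_
    simp
  have hdΦ (l : ℝ) (hl : 0 < l) :
      HasDerivAt Φ ((2 + 1 / c ^ 2) * |B l| + 1 / c * (1 / l ^ 2)) l := by
    have h1 := (hB.abs.integral_hasStrictDerivAt a l).hasDerivAt.const_mul (2 + 1 / c ^ 2)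
    have h2 := (((hasDerivAt_inv hl.ne').const_sub (1 / a)).const_mul (1 / c))
    refine ((h1.add h2).congr_of_eventuallyEq (.of_forall fun x => ?_)).congr_deriv ?_
    · simp [hΦ]
    · simp
  have hdI (l : ℝ) (hl : a ≤ l) : HasDerivAt (fun l => ∫ τ in a..l, |F τ|) |F l| l := by
    have hl0 : l ∈ Set.Ioi (0:ℝ) := lt_of_lt_of_le ha0 hl
    refine intervalIntegral.integral_hasDerivAt_right ?_ ?_ ?_
    · refine (hFa.mono ?_).intervalIntegrable
      rw [Set.uIcc_of_le hl]
      exact fun x hx => lt_of_lt_of_le ha0 hx.1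
    · exact hFa.stronglyMeasurableAtFilter isOpen_Ioi l hl0
    · exact hFa.continuousAt (isOpen_Ioi.mem_nhds hl0)
  have hΦ0 (l : ℝ) (hl : a ≤ l) : 0 ≤ Φ l := by
    have h1 : 0 ≤ ∫ τ in a..l, |B τ| :=
      intervalIntegral.integral_nonneg hl fun _ _ => abs_nonneg _
    have h2 : 0 ≤ 1 / a - 1 / l := sub_nonneg.2 (one_div_le_one_div_of_le ha0 hl)
    positivity
  have hgrowth (l : ℝ) (hl : l ∈ Set.Ioo a b) : 2 * w1 l * w2 l + c ^ 2 * (2 * w l * w1 l) ≤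
      2 * (((2 + 1 / c ^ 2) * |B l| + 1 / c * (1 / l ^ 2)) * E l + |F l| * √(E l)) := by
    have hl0 : 0 < l := ha0.trans hl.1
    set y := κ * w l / l with hy
    have hy2 : y ^ 2 ≤ w l ^ 2 * (1 / l ^ 2) := by
      have : κ ^ 2 ≤ 1 := by nlinarith
      calc y ^ 2 = κ ^ 2 * (w l ^ 2 * (1 / l ^ 2)) := by rw [hy]; field_simp
        _ ≤ 1 * (w l ^ 2 * (1 / l ^ 2)) := by gcongr
        _ = _ := one_mul _
    have hwE : w l ^ 2 ≤ 1 / c ^ 2 * E l := by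
      have : c ^ 2 * w l ^ 2 ≤ E l := by simp only [hE]; nlinarith [sq_nonneg (w1 l)]
      rw [one_div, inv_mul_eq_div, le_div_iff₀ (by positivity)]; linarith
    have hw1E : w1 l ^ 2 ≤ E l := by simp only [hE]; nlinarith [sq_nonneg (c * w l)]
    have hyc : c * y ^ 2 ≤ 1 / c * (1 / l ^ 2) * E l := by
      calc c * y ^ 2 ≤ c * ((1 / c ^ 2 * E l) * (1 / l ^ 2)) := by
            gcongr
            exact hy2.trans (by gcongr)
        _ = _ := by field_simp
    have hyE : y ^ 2 ≤ 1 / c ^ 2 * E l := by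
      have : 1 / l ^ 2 ≤ 1 := by
        rw [div_le_one (by positivity)]; nlinarith [hl.1]
      nlinarith [sq_nonneg (w l)]
    have hFw : w1 l * F l ≤ |F l| * √(E l) := by
      have : |w1 l| ≤ √(E l) := Real.abs_le_sqrt hw1E
      calc w1 l * F l ≤ |w1 l * F l| := le_abs_self _
        _ = |F l| * |w1 l| := by rw [abs_mul, mul_comm]
        _ ≤ _ := by gcongr
    have hfr : g l * (w1 l ^ 2 - 3 / 2 * y * w1 l) ≤
        ((2 + 1 / c ^ 2) * |B l| + 1 / c * (1 / l ^ 2)) * E l := by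
      have hB0 := abs_nonneg (B l)
      have hEl := hE0 l
      rcases le_total (g l) 0 with hneg | hpos
      · have h1 : -g l ≤ c := (neg_le_abs _).trans (hg l hl)
        have h2 : g l * (w1 l ^ 2 - 3 / 2 * y * w1 l) ≤ c * y ^ 2 := by
          nlinarith [mul_nonneg (neg_nonneg.2 hneg) (sq_nonneg (w1 l - 3 / 4 * y)),
            mul_nonneg (sub_nonneg.2 h1) (sq_nonneg y), mul_nonneg (neg_nonneg.2 hneg) (sq_nonneg y)]
        have h3 : 0 ≤ (2 + 1 / c ^ 2) * |B l| * E l := by positivity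
        linarith
      · have h2 : w1 l ^ 2 - 3 / 2 * y * w1 l ≤ (2 + 1 / c ^ 2) * E l := by
          nlinarith [sq_nonneg (w1 l + 3 / 4 * y), sq_nonneg y]
        have h3 : 0 ≤ 1 / c * (1 / l ^ 2) * E l := by positivity
        have h4 : g l * (w1 l ^ 2 - 3 / 2 * y * w1 l) ≤ |B l| * ((2 + 1 / c ^ 2) * E l) :=
          (mul_le_mul_of_nonneg_left h2 hpos).trans
            (mul_le_mul_of_nonneg_right (hgB l hl) (by positivity))
        linarith
    have hw2 : w2 l = F l + g l * w1 l - 3 / 2 * g l * y - c ^ 2 * w l := by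
      have := heq l hl
      have e : 3 / 2 * κ * g l * w l / l = 3 / 2 * g l * y := by rw [hy]; ring
      linarith
    rw [hw2]
    linarith
  have hbound (ε : ℝ) (hε : 0 < ε) :
      √(E b) ≤ Real.exp (Φ b) * (√(E a) + ε + ∫ l in a..b, |F l|) := by
    set Z : ℝ → ℝ := fun l => √(E l + ε ^ 2) with hZ
    have hpos (l : ℝ) : 0 < E l + ε ^ 2 := by have := hE0 l; positivity
    have hdY (l : ℝ) (hl : a ≤ l) := (((hdE l (ha0.trans_le hl)).add_const (ε ^ 2)).sqrt
      (hpos l).ne').mul (hdΦ l (ha0.trans_le hl)).neg.exp |>.sub (hdI l hl)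
    have hanti := antitoneOn_of_deriv_nonpos (convex_Icc a b)
      (fun l hl => (hdY l hl.1).continuousAt.continuousWithinAt)
      (fun l hl => (hdY l (interior_subset hl).1).differentiableAt.differentiableWithinAt)
      (fun l hl => by
        rw [interior_Icc] at hl
        rw [(hdY l hl.1.le).deriv]
        have hZ0 : 0 < √(E l + ε ^ 2) := Real.sqrt_pos.2 (hpos l)
        have hZ2 : √(E l + ε ^ 2) ^ 2 = E l + ε ^ 2 := Real.sq_sqrt (hpos l).le
        set A := (2 + 1 / c ^ 2) * |B l| + 1 / c * (1 / l ^ 2) with hA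
        have hA0 : 0 ≤ A := by positivity
        have hle : √(E l) ≤ √(E l + ε ^ 2) := Real.sqrt_le_sqrt (by nlinarith)
        have h1 : (2 * w1 l * w2 l + c ^ 2 * (2 * w l * w1 l)) / (2 * √(E l + ε ^ 2)) ≤
            A * √(E l + ε ^ 2) + |F l| := by
          rw [div_le_iff₀ (by positivity)]
          have h2 := hgrowth l hl
          have h3 : |F l| * √(E l) ≤ |F l| * √(E l + ε ^ 2) := by gcongr
          have h4 : A * E l ≤ A * √(E l + ε ^ 2) ^ 2 := by
            rw [hZ2]; gcongr; nlinarith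
          linarith
        have h5 : Real.exp (-Φ l) ≤ 1 := by
          rw [Real.exp_le_one_iff]; linarith [hΦ0 l hl.1.le]
        have h6 := Real.exp_pos (-Φ l)
        have h7 : |F l| * Real.exp (-Φ l) ≤ |F l| :=
          mul_le_of_le_one_right (abs_nonneg _) h5
        have h8 := mul_le_mul_of_nonneg_right h1 h6.le
        simp only [Pi.neg_apply]
        linarith)
    have hab' := hanti (Set.left_mem_Icc.2 hab) (Set.right_mem_Icc.2 hab) hab
    have hΦa : Φ a = 0 := by simp [hΦ]
    simp only [Pi.sub_apply, Pi.mul_apply, Pi.neg_apply, hΦa, intervalIntegral.integral_same,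
      neg_zero, Real.exp_zero, mul_one, sub_zero] at hab'
    have hZa : √(E a + ε ^ 2) ≤ √(E a) + ε := by
      rw [Real.sqrt_le_left (by positivity)]
      nlinarith [Real.sq_sqrt (hE0 a), Real.sqrt_nonneg (E a)]
    have hZb : √(E b) ≤ √(E b + ε ^ 2) := Real.sqrt_le_sqrt (by nlinarith)
    have hexp : Real.exp (Φ b) * Real.exp (-Φ b) = 1 := by rw [← Real.exp_add]; simp
    calc √(E b) ≤ √(E b + ε ^ 2) := hZb
      _ = Real.exp (Φ b) * (√(E b + ε ^ 2) * Real.exp (-Φ b)) := by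
        rw [mul_comm (√_), ← mul_assoc, hexp, one_mul]
      _ ≤ _ := by gcongr; linarith
  refine le_of_forall_pos_le_add fun ε hε => ?_
  have := hbound (ε / Real.exp (Φ b)) (by positivity)
  calc _ ≤ _ := this
    _ = _ := by
      have := (Real.exp_pos (Φ b)).ne'
      simp only [hΦ] at this ⊢
      field_simp
      ring

theorem rad_nonneg (p : Fin 4 → ℝ) : 0 ≤ rad p := Real.sqrt_nonneg _

theorem continuous_rad : Continuous rad := by unfold rad; fun_prop

theorem abs_succ_le_rad (p : Fin 4 → ℝ) (a : Fin 3) : |p a.succ| ≤ rad p := by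
  refine Real.abs_le_sqrt ?_
  exact Finset.single_le_sum (f := fun a : Fin 3 => p a.succ ^ 2) (fun i _ => sq_nonneg _)
    (Finset.mem_univ a)

theorem rad_ray {p : Fin 4 → ℝ} {l : ℝ} (hs : 0 < sfun p) (hl : 0 < l) :
    rad (ray p l) = l / sfun p * rad p := by
  have h : 0 ≤ l / sfun p := by positivity
  simp only [rad, ray, mul_pow]
  rw [← Finset.mul_sum, Real.sqrt_mul (sq_nonneg _), Real.sqrt_sq h]

theorem sfun_sq_eq {p : Fin 4 → ℝ} (hs : 0 < sfun p) : sfun p ^ 2 = p 0 ^ 2 - rad p ^ 2 :=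
  Real.sq_sqrt (Real.sqrt_pos.1 hs).le

theorem sfun_ray {p : Fin 4 → ℝ} {l : ℝ} (hs : 0 < sfun p) (hl : 0 < l) :
    sfun (ray p l) = l := by
  have h : (l / sfun p * p 0) ^ 2 - (l / sfun p * rad p) ^ 2 = l ^ 2 := by
    have h1 := sfun_sq_eq hs
    have h2 : (l / sfun p * p 0) ^ 2 - (l / sfun p * rad p) ^ 2
        = (l / sfun p) ^ 2 * sfun p ^ 2 := by rw [h1]; ring
    rw [h2]; field_simp
  rw [sfun, rad_ray hs hl, ray, h, Real.sqrt_sq hl.le]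

theorem ray_self {p : Fin 4 → ℝ} (hs : 0 < sfun p) : ray p (sfun p) = p := by
  funext i
  simp [ray, hs.ne']

theorem hpt_tail {q : Fin 4 → ℝ} (hs : 0 < sfun q) (ht : 0 ≤ q 0) :
    hpt (sfun q) (Fin.tail q) = q := by
  have h : √(sfun q ^ 2 + ∑ a : Fin 3, Fin.tail q a ^ 2) = q 0 := by
    rw [sfun_sq hs]
    simp [Fin.tail, ht]
  rw [hpt, h, Fin.cons_self_tail]

theorem rad_hpt (s : ℝ) (x : Fin 3 → ℝ) : rad (hpt s x) = √(∑ a, x a ^ 2) := by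
  simp [rad, hpt]

theorem vanishNearBdry.eq_zero {v : (Fin 4 → ℝ) → ℝ} (hv : vanishNearBdry v) {q : Fin 4 → ℝ}
    (hq : q 0 - 1 ≤ rad q) : v q = 0 ∧ ∀ α, pd α v q = 0 := by
  obtain ⟨δ, hδ, hv⟩ := hv
  have hev : v =ᶠ[nhds q] fun _ => 0 := by
    have : ∀ᶠ p in nhds q, p 0 - 1 - δ < rad p :=
      (((continuous_apply 0).sub continuous_const).sub continuous_const).continuousAt.eventually_lt
        continuous_rad.continuousAt (by simp only [Pi.sub_apply]; linarith)
    filter_upwards [this] with p hp using hv p hp.le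
  refine ⟨hev.eq_of_nhds, fun α => ?_⟩
  rw [pd, hev.fderiv_eq]
  simp

theorem abs_pd_le_sum (v : (Fin 4 → ℝ) → ℝ) (q : Fin 4 → ℝ) (α : Fin 4) :
    |pd α v q| ≤ ∑ β, |pd β v q| :=
  Finset.single_le_sum (f := fun β => |pd β v q|) (fun _ _ => abs_nonneg _) (Finset.mem_univ α)

theorem bddAbove_hyperboloid {v : (Fin 4 → ℝ) → ℝ} (hv : ContDiff ℝ (⊤ : ℕ∞) v)
    (hv0 : vanishNearBdry v) (s : ℝ) :
    BddAbove (Set.range fun x : Fin 3 → ℝ => |v (hpt s x)| + ⨆ α : Fin 4, |pd α v (hpt s x)|) := by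
  have hpt_cont : Continuous (hpt s) := by
    refine continuous_pi fun i => ?_
    refine Fin.cases ?_ (fun a => ?_) i
    · simp only [hpt, Fin.cons_zero]; fun_prop
    · simp only [hpt, Fin.cons_succ]; fun_prop
  have hG : Continuous fun x => |v (hpt s x)| + ∑ α : Fin 4, |pd α v (hpt s x)| := by
    have h1 : Continuous fun x => v (hpt s x) := hv.continuous.comp hpt_cont
    have h2 (α : Fin 4) : Continuous fun x => pd α v (hpt s x) :=
      (pd_contDiff hv α).continuous.comp hpt_cont
    fun_prop
  obtain ⟨C, hC⟩ := (isCompact_closedBall (0 : Fin 3 → ℝ) (s ^ 2)).exists_bound_of_continuousOn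
    hG.continuousOn
  refine ⟨C ⊔ 0, ?_⟩
  rintro _ ⟨x, rfl⟩
  by_cases hx : x ∈ Metric.closedBall (0 : Fin 3 → ℝ) (s ^ 2)
  · refine le_trans ?_ (((le_abs_self _).trans (hC x hx)).trans le_sup_left)
    simp only
    gcongr
    exact ciSup_le fun α => abs_pd_le_sum v _ α
  · have hx' : s ^ 2 < ‖x‖ := by simpa using hx
    have hnorm : ‖x‖ ≤ rad (hpt s x) := by
      rw [pi_norm_le_iff_of_nonneg (rad_nonneg _)]
      intro a
      simpa [hpt] using abs_succ_le_rad (hpt s x) a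
    have h0 : hpt s x 0 - 1 ≤ rad (hpt s x) := by
      have hr := rad_nonneg (hpt s x)
      have hsq : ∑ a, x a ^ 2 = rad (hpt s x) ^ 2 := by
        rw [rad_hpt, Real.sq_sqrt (Finset.sum_nonneg fun a _ => sq_nonneg _)]
      rw [sub_le_iff_le_add]
      generalize rad (hpt s x) = R at hr hsq hnorm ⊢
      rw [hpt, Fin.cons_zero, Real.sqrt_le_left (by linarith), hsq]
      nlinarith
    obtain ⟨h1, h2⟩ := hv0.eq_zero h0
    simp [h1, h2]

theorem Kset.bounds {s₀ s₁ : ℝ} (hs₀ : 2 ≤ s₀) (hs₁ : s₀ ≤ s₁) {p : Fin 4 → ℝ}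
    (hp : p ∈ Kset s₀ s₁) : 1 < p 0 ∧ s₀ ≤ sfun p ∧ sfun p ≤ s₁ ∧ sfun p ≤ p 0 := by
  obtain ⟨h1, h2, h3⟩ := hp
  have hr := rad_nonneg p
  refine ⟨by linarith, Real.le_sqrt_of_sq_le h1, ?_, ?_⟩
  · rw [sfun, Real.sqrt_le_left (by linarith)]; exact h2
  · rw [sfun, Real.sqrt_le_left (by linarith)]; nlinarith

theorem lam0_bounds {s₀ s₁ : ℝ} (hs₀ : 2 ≤ s₀) (hs₁ : s₀ ≤ s₁) {p : Fin 4 → ℝ}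
    (hp : p ∈ Kset s₀ s₁) :
    s₀ ≤ lam0 s₀ p ∧ lam0 s₀ p ≤ sfun p ∧ sfun p ≤ lam0 s₀ p * (p 0 - rad p) := by
  obtain ⟨ht, hs, -, -⟩ := Kset.bounds hs₀ hs₁ hp
  have hsq := sfun_sq_eq (p := p) (by linarith)
  have hr := rad_nonneg p
  have hrt : 0 < p 0 - rad p - 1 := by linarith [hp.2.2]
  have hd : 0 < p 0 - rad p := by linarith
  unfold lam0
  split_ifs with hcase
  · refine ⟨le_rfl, hs, ?_⟩
    rw [div_lt_div_iff₀ (by linarith) (by positivity)] at hcase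
    refine le_of_sq_le_sq ?_ (by positivity)
    rw [hsq, mul_pow]
    nlinarith
  · rw [not_lt, div_le_div_iff₀ (by positivity) (by linarith)] at hcase
    refine ⟨?_, ?_, ?_⟩
    · refine Real.le_sqrt_of_sq_le ?_
      rw [le_div_iff₀ hd]
      nlinarith
    · refine Real.sqrt_le_sqrt ?_
      rw [div_le_iff₀ hd]
      nlinarith [mul_pos hd hrt, mul_nonneg (add_nonneg hd.le hr) (mul_pos hd hrt).le]
    · refine le_of_sq_le_sq ?_ (by positivity)
      rw [hsq, mul_pow, Real.sq_sqrt (by have : 0 ≤ p 0 + rad p := by linarith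
                                         positivity)]
      exact le_of_eq (by field_simp; ring)

theorem ray_mem_Kset {s₀ s₁ : ℝ} (hs₀ : 2 ≤ s₀) (hs₁ : s₀ ≤ s₁) {p : Fin 4 → ℝ}
    (hp : p ∈ Kset s₀ s₁) {l : ℝ} (hl : lam0 s₀ p < l) (hl1 : l ≤ s₁) :
    ray p l ∈ Kset s₀ s₁ := by
  obtain ⟨ht, hs, -, -⟩ := Kset.bounds hs₀ hs₁ hp
  obtain ⟨h1, h2, h3⟩ := lam0_bounds hs₀ hs₁ hp
  have hl0 : 0 < l := by linarith
  have hsp : 0 < sfun p := by linarith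
  have hq := sfun_ray hsp hl0
  have hqs := sfun_sq_eq (p := ray p l) (by rw [hq]; exact hl0)
  rw [hq] at hqs
  refine ⟨by nlinarith, by nlinarith, ?_⟩
  rw [rad_ray hsp hl0]
  have hd : 0 < p 0 - rad p := by linarith [hp.2.2]
  have : 1 < l / sfun p * (p 0 - rad p) := by
    rw [div_mul_eq_mul_div, one_lt_div hsp]
    nlinarith
  simp only [ray]
  linarith

/-- The derivative of `v` along the ray through `p`. -/
def rayDeriv (v : (Fin 4 → ℝ) → ℝ) (p : Fin 4 → ℝ) (l : ℝ) : ℝ :=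
  ∑ i, p i / sfun p * pd i v (ray p l)

/-- The second derivative of `v` along the ray through `p`. -/
def rayDeriv₂ (v : (Fin 4 → ℝ) → ℝ) (p : Fin 4 → ℝ) (l : ℝ) : ℝ :=
  ∑ i, p i / sfun p * ∑ j, p j / sfun p * pd j (pd i v) (ray p l)

/-- The rescaled unknown `l ^ (3/2) v` along the ray through `p`. -/
def rayProfile (v : (Fin 4 → ℝ) → ℝ) (p : Fin 4 → ℝ) (l : ℝ) : ℝ :=
  l ^ ((3:ℝ)/2) * v (ray p l)

/-- The derivative of `rayProfile`. -/
def rayProfileDeriv (v : (Fin 4 → ℝ) → ℝ) (p : Fin 4 → ℝ) (l : ℝ) : ℝ :=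
  l ^ ((3:ℝ)/2) * rayDeriv v p l + 3 / 2 * l ^ ((1:ℝ)/2) * v (ray p l)

/-- The second derivative of `rayProfile`. -/
def rayProfileDeriv₂ (v : (Fin 4 → ℝ) → ℝ) (p : Fin 4 → ℝ) (l : ℝ) : ℝ :=
  l ^ ((3:ℝ)/2) *
    (rayDeriv₂ v p l + 3 / l * rayDeriv v p l + 3 / (4 * l ^ 2) * v (ray p l))

theorem continuous_ray (p : Fin 4 → ℝ) : Continuous (ray p) := by unfold ray; fun_prop

theorem hasDerivAt_rayDeriv {v : (Fin 4 → ℝ) → ℝ} (hv : ContDiff ℝ (⊤ : ℕ∞) v)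
    (p : Fin 4 → ℝ) (l : ℝ) : HasDerivAt (rayDeriv v p) (rayDeriv₂ v p l) l :=
  HasDerivAt.fun_sum fun i _ =>
    (hasDerivAt_comp_ray (pd_contDiff hv i) p l).const_mul (p i / sfun p)

theorem continuous_rayDeriv {v : (Fin 4 → ℝ) → ℝ} (hv : ContDiff ℝ (⊤ : ℕ∞) v)
    (p : Fin 4 → ℝ) : Continuous (rayDeriv v p) :=
  continuous_finsetSum _ fun i _ => continuous_const.mul
    ((pd_contDiff hv i).continuous.comp (continuous_ray p))

theorem continuous_rayDeriv₂ {v : (Fin 4 → ℝ) → ℝ} (hv : ContDiff ℝ (⊤ : ℕ∞) v)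
    (p : Fin 4 → ℝ) : Continuous (rayDeriv₂ v p) :=
  continuous_finsetSum _ fun i _ => continuous_const.mul <|
    continuous_rayDeriv (pd_contDiff hv i) p

theorem hasDerivAt_rayProfile {v : (Fin 4 → ℝ) → ℝ} (hv : ContDiff ℝ (⊤ : ℕ∞) v)
    (p : Fin 4 → ℝ) {l : ℝ} (hl : 0 < l) :
    HasDerivAt (rayProfile v p) (rayProfileDeriv v p l) l := by
  refine ((Real.hasDerivAt_rpow_const (p := (3:ℝ)/2) (Or.inl hl.ne')).mul
    (hasDerivAt_comp_ray hv p l)).congr_deriv ?_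
  rw [rayProfileDeriv, rayDeriv, show (3:ℝ)/2 - 1 = 1/2 by norm_num]
  ring

theorem hasDerivAt_rayProfileDeriv {v : (Fin 4 → ℝ) → ℝ} (hv : ContDiff ℝ (⊤ : ℕ∞) v)
    (p : Fin 4 → ℝ) {l : ℝ} (hl : 0 < l) :
    HasDerivAt (rayProfileDeriv v p) (rayProfileDeriv₂ v p l) l := by
  refine (((Real.hasDerivAt_rpow_const (p := (3:ℝ)/2) (Or.inl hl.ne')).mul
    (hasDerivAt_rayDeriv hv p l)).add
    (((Real.hasDerivAt_rpow_const (p := (1:ℝ)/2) (Or.inl hl.ne')).const_mul (3/2)).mul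
      (hasDerivAt_comp_ray hv p l))).congr_deriv ?_
  rw [rayProfileDeriv₂, Real.rpow_sub_one hl.ne', Real.rpow_sub_one hl.ne',
    rpow_three_halves hl, ← rayDeriv]
  field_simp
  ring

/-- Along rays the equation becomes a damped oscillator. The last term compensates the difference
between `h` and `(t/s) h` in the zeroth-order term of `Rfun`. -/
theorem rayProfile_equation {v h f : (Fin 4 → ℝ) → ℝ} (hv : ContDiff ℝ (⊤ : ℕ∞) v) {c : ℝ}
    {p : Fin 4 → ℝ} (hs : 0 < sfun p) (ht : 0 < p 0) {l : ℝ} (hl : 0 < l)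
    (heq : box v (ray p l) - h (ray p l) * pd 0 v (ray p l) + c ^ 2 * v (ray p l)
      = f (ray p l)) :
    rayProfileDeriv₂ v p l + c ^ 2 * rayProfile v p l =
      Rfun h v (ray p l) + l ^ ((3:ℝ)/2) * f (ray p l)
        + p 0 / sfun p * h (ray p l) * rayProfileDeriv v p l
        - 3 / 2 * (1 - sfun p / p 0) * (p 0 / sfun p * h (ray p l)) * rayProfile v p l / l := by
  have hq := sfun_ray hs hl
  have h0 : 0 < ray p l 0 := by simp only [ray]; positivity
  have key := klein_gordon_radial (h := h) hv (by rw [hq]; exact hl) h0 heq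
  have hn (i : Fin 4) : ray p l i = l * (p i / sfun p) := by simp only [ray]; ring
  have e1 : ∑ i, ray p l i / l * pd i v (ray p l) = rayDeriv v p l := by
    refine Finset.sum_congr rfl fun i _ => ?_
    rw [hn, mul_div_cancel_left₀ _ hl.ne']
  have e1' : ∑ i, ray p l i / l ^ 2 * pd i v (ray p l) = rayDeriv v p l / l := by
    rw [← e1, Finset.sum_div]
    exact Finset.sum_congr rfl fun i _ => by field_simp
  have e2 : ∑ i, ∑ j, ray p l i * ray p l j / l ^ 2 * pd i (pd j v) (ray p l)
      = rayDeriv₂ v p l := by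
    simp only [rayDeriv₂, Finset.mul_sum]
    refine Finset.sum_congr rfl fun i _ => Finset.sum_congr rfl fun j _ => ?_
    rw [pd_comm hv i j, hn i, hn j]
    field_simp
  have e3 : ray p l 0 / l = p 0 / sfun p := by rw [hn, mul_div_cancel_left₀ _ hl.ne']
  have e4 : l / ray p l 0 = sfun p / p 0 := by rw [← inv_div, e3, inv_div]
  rw [hq, e1, e1', e2, e3, e4] at key
  rw [rayProfileDeriv₂, rayProfileDeriv, rayProfile]
  have hx : l ^ ((3:ℝ)/2) * v (ray p l) / l = l ^ ((1:ℝ)/2) * v (ray p l) := by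
    rw [rpow_three_halves hl]; field_simp
  calc _ = _ := by ring
    _ = _ := key
    _ = _ := by rw [mul_div_assoc, hx]; ring

theorem sqrt_rayEnergy_le {c CS s₀ s₁ : ℝ} (hc : 0 < c) (hs₀ : 2 ≤ s₀) (hs₁ : s₀ ≤ s₁)
    {v h f S : (Fin 4 → ℝ) → ℝ} (hv : ContDiff ℝ (⊤ : ℕ∞) v) (hh : Continuous h)
    (hS : Continuous S)
    (heq : ∀ p ∈ Kset s₀ s₁, box v p - h p * pd 0 v p + c ^ 2 * v p = f p)
    (hhc : ∀ p ∈ Kset s₀ s₁, |(p 0 / sfun p) * h p| ≤ c)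
    (hSh : ∀ p ∈ Kset s₀ s₁, S p + (p 0 / sfun p) * h p ≤ 0)
    {p : Fin 4 → ℝ} (hp : p ∈ Kset s₀ s₁)
    (hSC : (∫ lam in (lam0 s₀ p)..s₁, |S (ray p lam)|) ≤ CS) :
    √(rayProfileDeriv v p (sfun p) ^ 2 + c ^ 2 * rayProfile v p (sfun p) ^ 2) ≤
      Real.exp ((2 + 1 / c ^ 2) * CS + 1 / c) *
        (√(rayProfileDeriv v p (lam0 s₀ p) ^ 2 + c ^ 2 * rayProfile v p (lam0 s₀ p) ^ 2)
          + ∫ τ in (lam0 s₀ p)..(sfun p),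
              |Rfun h v (ray p τ) + τ ^ ((3:ℝ)/2) * f (ray p τ)|) := by
  obtain ⟨ht, hss, hss1, hst⟩ := Kset.bounds hs₀ hs₁ hp
  obtain ⟨ha, hab, -⟩ := lam0_bounds hs₀ hs₁ hp
  have hs : 0 < sfun p := by linarith
  have ht0 : 0 < p 0 := by linarith
  set a := lam0 s₀ p with ha_def
  set κ := 1 - sfun p / p 0 with hκ
  have hmem (l : ℝ) (hl : l ∈ Set.Ioo a (sfun p)) : ray p l ∈ Kset s₀ s₁ :=
    ray_mem_Kset hs₀ hs₁ hp hl.1 (hl.2.le.trans hss1)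
  have hcoef (l : ℝ) (hl : 0 < l) : ray p l 0 / sfun (ray p l) = p 0 / sfun p := by
    rw [sfun_ray hs hl, ray]; field_simp
  set g : ℝ → ℝ := fun l => p 0 / sfun p * h (ray p l) with hg
  set F : ℝ → ℝ := fun l => rayProfileDeriv₂ v p l + c ^ 2 * rayProfile v p l
    - g l * rayProfileDeriv v p l + 3 / 2 * κ * g l * rayProfile v p l / l with hF
  have hFR (l : ℝ) (hl : l ∈ Set.Ioo a (sfun p)) :
      F l = Rfun h v (ray p l) + l ^ ((3:ℝ)/2) * f (ray p l) := by
    have := rayProfile_equation hv hs ht0 (by linarith [hl.1]) (heq _ (hmem l hl))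
    simp only [hF, this, hg]
    ring
  have hFc : ContinuousOn F (Set.Ioi 0) := by
    have hgc : ContinuousOn g (Set.Ioi 0) :=
      (continuous_const.mul (hh.comp (continuous_ray p))).continuousOn
    have hvc : ContinuousOn (fun l => v (ray p l)) (Set.Ioi 0) :=
      (hv.continuous.comp (continuous_ray p)).continuousOn
    have hrc (e : ℝ) : ContinuousOn (fun l : ℝ => l ^ e) (Set.Ioi 0) :=
      continuousOn_id.rpow_const fun l hl => Or.inl (ne_of_gt hl)
    have hw : ContinuousOn (rayProfile v p) (Set.Ioi 0) := (hrc _).mul hvc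
    have hw1 : ContinuousOn (rayProfileDeriv v p) (Set.Ioi 0) :=
      ((hrc _).mul (continuous_rayDeriv hv p).continuousOn).add
        ((continuousOn_const.mul (hrc _)).mul hvc)
    have hw2 : ContinuousOn (rayProfileDeriv₂ v p) (Set.Ioi 0) := by
      refine (hrc _).mul (((continuous_rayDeriv₂ hv p).continuousOn.add
        (.mul (.div continuousOn_const continuousOn_id ?_)
          (continuous_rayDeriv hv p).continuousOn)).add
        (.mul (.div continuousOn_const (by fun_prop) ?_) hvc))
      · exact fun l hl => ne_of_gt hl
      · intro l hl
        have : (0:ℝ) < l := hl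
        positivity
    exact ((hw2.add (continuousOn_const.mul hw)).sub (hgc.mul hw1)).add
      (((continuousOn_const.mul hgc).mul hw).div continuousOn_id fun l hl => ne_of_gt hl)
  have hBc : Continuous fun l => S (ray p l) := hS.comp (continuous_ray p)
  have hκ0 : 0 ≤ κ := by rw [hκ, sub_nonneg, div_le_one ht0]; exact hst
  have hκ1 : κ ≤ 1 := by rw [hκ, sub_le_self_iff]; positivity
  have main := sqrt_energy_le (κ := κ) (w := rayProfile v p) (w1 := rayProfileDeriv v p)
    (w2 := rayProfileDeriv₂ v p) (g := g) (B := fun l => S (ray p l)) (F := F)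
    hc (hs₀.trans ha) hab hκ0 hκ1
    (fun l hl => hasDerivAt_rayProfile hv p hl) (fun l hl => hasDerivAt_rayProfileDeriv hv p hl)
    hFc hBc (fun l _ => by simp only [hF]; ring)
    (fun l hl => by
      have := hhc _ (hmem l hl)
      rwa [hcoef l (by linarith [hl.1])] at this)
    (fun l hl => by
      have := hSh _ (hmem l hl)
      rw [hcoef l (by linarith [hl.1])] at this
      have := neg_abs_le (S (ray p l))
      simp only [hg]
      linarith)
  have hint : ∫ l in a..sfun p, |F l| = ∫ τ in a..sfun p,
      |Rfun h v (ray p τ) + τ ^ ((3:ℝ)/2) * f (ray p τ)| :=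
    intervalIntegral.integral_congr_Ioo_of_le hab fun l hl => by simp only [hFR l hl]
  rw [hint] at main
  refine main.trans (mul_le_mul_of_nonneg_right (Real.exp_le_exp.2 ?_) ?_)
  · have h1 : ∫ l in a..sfun p, |S (ray p l)| ≤ CS :=
      (intervalIntegral.integral_mono_interval le_rfl hab hss1
        (Filter.Eventually.of_forall fun _ => abs_nonneg _)
        (hBc.abs.intervalIntegrable _ _)).trans hSC
    have h2 : 1 / a - 1 / sfun p ≤ 1 := by
      have h3 : 1 / a ≤ 1 := by rw [div_le_one (by linarith)]; linarith
      have h4 : 0 ≤ 1 / sfun p := by positivity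
      linarith
    have h5 : 1 / c * (1 / a - 1 / sfun p) ≤ 1 / c := mul_le_of_le_one_right (by positivity) h2
    gcongr
  · have := intervalIntegral.integral_nonneg (f := fun τ =>
      |Rfun h v (ray p τ) + τ ^ ((3:ℝ)/2) * f (ray p τ)|) (μ := volume) hab
      fun _ _ => abs_nonneg _
    positivity

theorem abs_Lop_le_vone (v : (Fin 4 → ℝ) → ℝ) (p : Fin 4 → ℝ) (a : Fin 3) :
    |Lop a v p| ≤ vone v p :=
  (le_ciSup (f := fun a => |Lop a v p|) (Set.finite_range _).bddAbove a).trans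
    (le_sup_right.trans le_sup_right)

theorem abs_le_vone (v : (Fin 4 → ℝ) → ℝ) (p : Fin 4 → ℝ) : |v p| ≤ vone v p := le_sup_left

/-- The full gradient is controlled by the radial derivative and the boosts. -/
theorem weighted_gradient_le (v : (Fin 4 → ℝ) → ℝ) {p : Fin 4 → ℝ} (hs : 0 < sfun p)
    (hst : sfun p ≤ p 0) :
    sfun p ^ ((3:ℝ)/2) * (sfun p / p 0 * ⨆ α : Fin 4, |pd α v p|) ≤
      |rayProfileDeriv v p (sfun p)| + 6 * (sfun p ^ ((1:ℝ)/2) * vone v p) := by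
  have ht : 0 < p 0 := by linarith
  set s := sfun p with hs_def
  set σ := s ^ ((1:ℝ)/2) with hσ
  have hσ0 : 0 < σ := Real.rpow_pos_of_pos hs _
  set N := vone v p with hN
  have hvN := abs_le_vone v p
  have hN0 : 0 ≤ N := (abs_nonneg _).trans hvN
  have hsq := sfun_sq_eq hs
  have hrt : rad p ≤ p 0 := by nlinarith [rad_nonneg p, sq_nonneg s]
  have hxa (a : Fin 3) : |p a.succ| ≤ p 0 := (abs_succ_le_rad p a).trans hrt
  set D := rayDeriv v p s with hD
  have hw1 : rayProfileDeriv v p s = s * σ * D + 3 / 2 * σ * v p := by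
    rw [rayProfileDeriv, rpow_three_halves hs, ray_self hs]
  have hDs : ∑ i, p i * pd i v p = s * D := by
    rw [hD, rayDeriv, ray_self hs, Finset.mul_sum, ← hs_def]
    exact Finset.sum_congr rfl fun i _ => by field_simp
  have hsum : |∑ a : Fin 3, p a.succ * Lop a v p| ≤ 3 * (p 0 * N) := by
    calc _ ≤ ∑ a : Fin 3, |p a.succ * Lop a v p| := Finset.abs_sum_le_sum_abs _ _
      _ ≤ ∑ _a : Fin 3, p 0 * N := Finset.sum_le_sum fun a _ => by
        rw [abs_mul]
        exact mul_le_mul (hxa a) (abs_Lop_le_vone v p a) (abs_nonneg _) ht.le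
      _ = _ := by simp
  have hsD : σ * (s * |D|) ≤ |rayProfileDeriv v p s| + 3 / 2 * (σ * N) := by
    have h1 : s * σ * D = rayProfileDeriv v p s - 3 / 2 * σ * v p := by rw [hw1]; ring
    calc σ * (s * |D|) = |s * σ * D| := by
          rw [abs_mul, abs_of_pos (by positivity : 0 < s * σ)]; ring
      _ ≤ |rayProfileDeriv v p s| + |3 / 2 * σ * v p| := by rw [h1]; exact abs_sub _ _
      _ = |rayProfileDeriv v p s| + 3 / 2 * (σ * |v p|) := by
          rw [abs_mul, abs_of_pos (by positivity : 0 < 3 / 2 * σ)]; ring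
      _ ≤ _ := by gcongr
  have h0 : s ^ 2 * |pd 0 v p| ≤ p 0 * (s * |D| + 3 * N) := by
    have h1 : s ^ 2 * pd 0 v p = p 0 * (s * D) - ∑ a : Fin 3, p a.succ * Lop a v p := by
      rw [sum_mul_Lop v hs, hDs]; ring
    calc s ^ 2 * |pd 0 v p| = |s ^ 2 * pd 0 v p| := by
          rw [abs_mul, abs_of_pos (by positivity : 0 < s ^ 2)]
      _ ≤ |p 0 * (s * D)| + |∑ a : Fin 3, p a.succ * Lop a v p| := by rw [h1]; exact abs_sub _ _
      _ ≤ p 0 * (s * |D|) + 3 * (p 0 * N) := by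
          gcongr
          rw [abs_mul, abs_mul, abs_of_pos ht, abs_of_pos hs]
      _ = _ := by ring
  have h0' : s ^ 2 / p 0 * |pd 0 v p| ≤ s * |D| + 3 * N := by
    rw [div_mul_eq_mul_div, div_le_iff₀ ht]; linarith
  have ha (a : Fin 3) : s ^ 2 / p 0 * |pd a.succ v p| ≤ s * |D| + 4 * N := by
    have h1 : p 0 * pd a.succ v p = Lop a v p - p a.succ * pd 0 v p := by rw [Lop]; ring
    have h2 : p 0 * |pd a.succ v p| ≤ N + p 0 * |pd 0 v p| := by
      calc p 0 * |pd a.succ v p| = |p 0 * pd a.succ v p| := by rw [abs_mul, abs_of_pos ht]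
        _ ≤ |Lop a v p| + |p a.succ * pd 0 v p| := by rw [h1]; exact abs_sub _ _
        _ ≤ _ := by
          rw [abs_mul]
          gcongr
          · exact abs_Lop_le_vone v p a
          · exact hxa a
    have h3 : s ^ 2 / p 0 ^ 2 ≤ 1 := by rw [div_le_one (by positivity)]; gcongr
    calc s ^ 2 / p 0 * |pd a.succ v p| = s ^ 2 / p 0 ^ 2 * (p 0 * |pd a.succ v p|) := by
          field_simp
      _ ≤ s ^ 2 / p 0 ^ 2 * (N + p 0 * |pd 0 v p|) := by gcongr
      _ = s ^ 2 / p 0 ^ 2 * N + s ^ 2 / p 0 * |pd 0 v p| := by field_simp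
      _ ≤ 1 * N + (s * |D| + 3 * N) := by gcongr
      _ = _ := by ring
  obtain ⟨α, hα⟩ := exists_eq_ciSup_of_finite (f := fun α : Fin 4 => |pd α v p|)
  have hα' : s ^ 2 / p 0 * |pd α v p| ≤ s * |D| + 4 * N := by
    refine Fin.cases ?_ ha α
    linarith
  rw [← hα, rpow_three_halves hs]
  calc s * σ * (s / p 0 * |pd α v p|) = σ * (s ^ 2 / p 0 * |pd α v p|) := by ring
    _ ≤ σ * (s * |D| + 4 * N) := by gcongr
    _ = σ * (s * |D|) + 4 * (σ * N) := by ring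
    _ ≤ _ := by have : 0 ≤ σ * N := by positivity
                linarith

theorem sqrt_energy_le_abs {x y c : ℝ} (hc : 0 < c) :
    √(x ^ 2 + c ^ 2 * y ^ 2) ≤ |x| + c * |y| := by
  rw [Real.sqrt_le_left (by positivity), add_sq, sq_abs, mul_pow, sq_abs]
  have : 0 ≤ 2 * |x| * (c * |y|) := by positivity
  linarith

theorem initial_energy_le {c s₀ s₁ : ℝ} (hc : 0 < c) (hs₀ : 2 ≤ s₀) (hs₁ : s₀ ≤ s₁)
    {v : (Fin 4 → ℝ) → ℝ} (hv : ContDiff ℝ (⊤ : ℕ∞) v) (hv0 : vanishNearBdry v)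
    {p : Fin 4 → ℝ} (hp : p ∈ Kset s₀ s₁)
    (hnear : rad p / p 0 < (s₀ ^ 2 - 1) / (s₀ ^ 2 + 1)) :
    √(rayProfileDeriv v p s₀ ^ 2 + c ^ 2 * rayProfile v p s₀ ^ 2) ≤
      s₀ ^ ((3:ℝ)/2) * (4 * (s₀ ^ 2 + 1) + 2 + c) *
        ⨆ x : Fin 3 → ℝ, (|v (hpt s₀ x)| + ⨆ α : Fin 4, |pd α v (hpt s₀ x)|) := by
  obtain ⟨ht, hss, hss1, hst⟩ := Kset.bounds hs₀ hs₁ hp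
  have hs : 0 < sfun p := by linarith
  have hs0 : 0 < s₀ := by linarith
  have hr := rad_nonneg p
  set q := ray p s₀ with hq
  set M := ⨆ x : Fin 3 → ℝ, (|v (hpt s₀ x)| + ⨆ α : Fin 4, |pd α v (hpt s₀ x)|)
  have hqs : sfun q = s₀ := sfun_ray hs hs0
  have hq0 : 0 ≤ q 0 := by simp only [hq, ray]; positivity
  have hqh : hpt s₀ (Fin.tail q) = q := by
    have := hpt_tail (q := q) (by rw [hqs]; exact hs0) hq0
    rwa [hqs] at this
  have hM : |v q| + ⨆ α : Fin 4, |pd α v q| ≤ M := by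
    have := le_ciSup (bddAbove_hyperboloid hv hv0 s₀) (Fin.tail q)
    simpa only [hqh] using this
  set m := ⨆ α : Fin 4, |pd α v q| with hm
  have hpm (α : Fin 4) : |pd α v q| ≤ m :=
    le_ciSup (f := fun α => |pd α v q|) (Set.finite_range _).bddAbove α
  have hm0 : 0 ≤ m := (abs_nonneg _).trans (hpm 0)
  have hsq := sfun_sq_eq hs
  have hrt : rad p ≤ p 0 := by linarith [hp.2.2]
  have hratio : p 0 / sfun p ≤ s₀ ^ 2 + 1 := by
    rw [div_lt_div_iff₀ (by linarith) (by positivity)] at hnear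
    rw [div_le_iff₀ hs]
    refine le_of_sq_le_sq ?_ (by positivity)
    rw [mul_pow, hsq]
    have h1 : (rad p * (s₀ ^ 2 + 1)) ^ 2 ≤ ((s₀ ^ 2 - 1) * p 0) ^ 2 := by gcongr
    nlinarith [mul_nonneg (sq_nonneg (p 0)) (by nlinarith : 0 ≤ 4 * s₀ ^ 2 - 1)]
  have hn (i : Fin 4) : |p i / sfun p| ≤ s₀ ^ 2 + 1 := by
    rw [abs_div, abs_of_pos hs]
    refine le_trans ?_ hratio
    gcongr
    refine Fin.cases ?_ (fun a => ?_) i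
    · rw [abs_of_pos (by linarith)]
    · exact (abs_succ_le_rad p a).trans hrt
  have hD : |rayDeriv v p s₀| ≤ 4 * ((s₀ ^ 2 + 1) * m) := by
    calc _ ≤ ∑ i, |p i / sfun p * pd i v q| := Finset.abs_sum_le_sum_abs _ _
      _ ≤ ∑ _i : Fin 4, (s₀ ^ 2 + 1) * m := Finset.sum_le_sum fun i _ => by
        rw [abs_mul]
        exact mul_le_mul (hn i) (hpm i) (abs_nonneg _) (by positivity)
      _ = _ := by simp
  have hrp : 0 < s₀ ^ ((3:ℝ)/2) := Real.rpow_pos_of_pos hs0 _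
  have hhalf : s₀ ^ ((1:ℝ)/2) ≤ s₀ ^ ((3:ℝ)/2) :=
    Real.rpow_le_rpow_of_exponent_le (by linarith) (by norm_num)
  have hw1 : |rayProfileDeriv v p s₀| ≤
      s₀ ^ ((3:ℝ)/2) * (4 * ((s₀ ^ 2 + 1) * m)) + 3 / 2 * s₀ ^ ((3:ℝ)/2) * |v q| := by
    have hhp : 0 < s₀ ^ ((1:ℝ)/2) := Real.rpow_pos_of_pos hs0 _
    refine (abs_add_le _ _).trans ?_
    rw [abs_mul, abs_mul, abs_of_pos hrp, abs_of_pos (by positivity : 0 < 3 / 2 * s₀ ^ ((1:ℝ)/2))]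
    gcongr
  have hw : |rayProfile v p s₀| = s₀ ^ ((3:ℝ)/2) * |v q| := by
    rw [rayProfile, abs_mul, abs_of_pos hrp]
  have hvq := abs_nonneg (v q)
  refine (sqrt_energy_le_abs hc).trans ?_
  rw [hw]
  calc _ ≤ s₀ ^ ((3:ℝ)/2) * ((4 * (s₀ ^ 2 + 1)) * m + (3 / 2 + c) * |v q|) := by linarith
    _ ≤ s₀ ^ ((3:ℝ)/2) * ((4 * (s₀ ^ 2 + 1)) * M + (2 + c) * M) := by
      gcongr
      · linarith
      · norm_num
      · linarith
    _ = _ := by ring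

theorem initial_energy_eq_zero {c s₀ s₁ : ℝ} (hs₀ : 2 ≤ s₀) (hs₁ : s₀ ≤ s₁)
    {v : (Fin 4 → ℝ) → ℝ} (hv0 : vanishNearBdry v) {p : Fin 4 → ℝ} (hp : p ∈ Kset s₀ s₁)
    (hfar : ¬ rad p / p 0 < (s₀ ^ 2 - 1) / (s₀ ^ 2 + 1)) :
    √(rayProfileDeriv v p (lam0 s₀ p) ^ 2 + c ^ 2 * rayProfile v p (lam0 s₀ p) ^ 2) = 0 := by
  obtain ⟨ht, hss, hss1, hst⟩ := Kset.bounds hs₀ hs₁ hp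
  obtain ⟨h1, h2, h3⟩ := lam0_bounds hs₀ hs₁ hp
  have hs : 0 < sfun p := by linarith
  have hl : 0 < lam0 s₀ p := by linarith
  have hd : 0 < p 0 - rad p := by linarith [hp.2.2]
  have hr := rad_nonneg p
  have hle : lam0 s₀ p * (p 0 - rad p) ≤ sfun p := by
    refine le_of_sq_le_sq ?_ hs.le
    rw [mul_pow, sfun_sq_eq hs, lam0, if_neg hfar, Real.sq_sqrt (by
      have : 0 ≤ p 0 + rad p := by linarith
      positivity)]
    exact le_of_eq (by field_simp; ring)
  have hbdry : ray p (lam0 s₀ p) 0 - 1 ≤ rad (ray p (lam0 s₀ p)) := by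
    rw [rad_ray hs hl]
    have : lam0 s₀ p / sfun p * (p 0 - rad p) ≤ 1 := by
      rw [div_mul_eq_mul_div, div_le_one hs]; exact hle
    simp only [ray]
    linarith
  obtain ⟨hv, hdv⟩ := hv0.eq_zero hbdry
  simp [rayProfileDeriv, rayProfile, rayDeriv, hv, hdv]

/-- Sharp decay estimate for the damped Klein–Gordon equation on hyperboloids. -/
theorem stmt_11 : ∀ (c CS s₀ η : ℝ), 0 < c → 2 ≤ s₀ → ∃ K > (0:ℝ),
    ∀ s₁ : ℝ, s₀ ≤ s₁ →
    ∀ v h f S : (Fin 4 → ℝ) → ℝ,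
      ContDiff ℝ (⊤ : ℕ∞) v → ContDiff ℝ (⊤ : ℕ∞) h → ContDiff ℝ (⊤ : ℕ∞) f → Continuous S →
      vanishNearBdry v →
      -- the damped Klein–Gordon equation
      (∀ p ∈ Kset s₀ s₁, box v p - h p * pd 0 v p + c ^ 2 * v p = f p) →
      -- |(t/s) h| ≤ c
      (∀ p ∈ Kset s₀ s₁, |(p 0 / sfun p) * h p| ≤ c) →
      -- the barrier function S
      (∀ p ∈ Kset s₀ s₁, S p + (p 0 / sfun p) * h p ≤ 0) →
      (∀ p ∈ Kset s₀ s₁, (∫ lam in (lam0 s₀ p)..s₁, |S (ray p lam)|) ≤ CS) →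
      ∀ p ∈ Kset s₀ s₁,
        (sfun p / p 0) ^ η * (sfun p) ^ ((3:ℝ)/2) *
            (|v p| + (sfun p / p 0) * ⨆ α : Fin 4, |pd α v p|)
          ≤ K * Vfun s₀ η h v f p := by
  intro c CS s₀ η hc hs₀
  set C₀ := Real.exp ((2 + 1 / c ^ 2) * CS + 1 / c) with hC₀
  set C₁ := s₀ ^ ((3:ℝ)/2) * (4 * (s₀ ^ 2 + 1) + 2 + c) with hC₁
  have hs₀' : 0 < s₀ := by linarith
  have hC₀pos : 0 < C₀ := Real.exp_pos _
  have hC₁pos : 0 < C₁ := by positivity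
  refine ⟨(1 / c + 1) * C₀ * (C₁ + 1) + 6, by positivity, ?_⟩
  intro s₁ hs₁ v h f S hv hh _ hS hv0 heq hhc hSh hSC p hp
  obtain ⟨ht, hss, -, hst⟩ := Kset.bounds hs₀ hs₁ hp
  have hab := (lam0_bounds hs₀ hs₁ hp).2.1
  have hs : 0 < sfun p := by linarith
  have ht0 : 0 < p 0 := by linarith
  have hθ : 0 < (sfun p / p 0) ^ η := Real.rpow_pos_of_pos (by positivity) _
  have henergy := sqrt_rayEnergy_le hc hs₀ hs₁ hv hh.continuous hS heq hhc hSh hp (hSC p hp)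
  have hgrad := weighted_gradient_le v hs hst
  have hN : 0 ≤ sfun p ^ ((1:ℝ)/2) * vone v p :=
    mul_nonneg (Real.rpow_nonneg hs.le _) ((abs_nonneg _).trans (abs_le_vone v p))
  have hI : 0 ≤ ∫ τ in (lam0 s₀ p)..(sfun p),
      |Rfun h v (ray p τ) + τ ^ ((3:ℝ)/2) * f (ray p τ)| :=
    intervalIntegral.integral_nonneg hab fun _ _ => abs_nonneg _
  set M := ⨆ x : Fin 3 → ℝ, (|v (hpt s₀ x)| + ⨆ α : Fin 4, |pd α v (hpt s₀ x)|) with hM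
  have hM0 : 0 ≤ M := Real.iSup_nonneg fun x =>
    add_nonneg (abs_nonneg _) (Real.iSup_nonneg fun α => abs_nonneg _)
  set M' := if rad p / p 0 < (s₀ ^ 2 - 1) / (s₀ ^ 2 + 1) then M else 0 with hM'
  have hM'0 : 0 ≤ M' := by rw [hM']; split_ifs <;> simp [hM0]
  have hinit : √(rayProfileDeriv v p (lam0 s₀ p) ^ 2 + c ^ 2 * rayProfile v p (lam0 s₀ p) ^ 2)
      ≤ C₁ * M' := by
    by_cases hnear : rad p / p 0 < (s₀ ^ 2 - 1) / (s₀ ^ 2 + 1)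
    · rw [hM', if_pos hnear, lam0, if_pos hnear]
      exact initial_energy_le hc hs₀ hs₁ hv hv0 hp hnear
    · rw [initial_energy_eq_zero hs₀ hs₁ hv0 hp hnear]
      positivity
  set I := ∫ τ in (lam0 s₀ p)..(sfun p),
    |Rfun h v (ray p τ) + τ ^ ((3:ℝ)/2) * f (ray p τ)| with hIdef
  set w := rayProfile v p (sfun p) with hw
  set w' := rayProfileDeriv v p (sfun p) with hw'
  set X := √(w' ^ 2 + c ^ 2 * w ^ 2) with hX
  have hX1 : |w'| ≤ X := Real.abs_le_sqrt (by nlinarith [sq_nonneg (c * w)])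
  have hX2 : |w| ≤ 1 / c * X := by
    have : |c * w| ≤ X := Real.abs_le_sqrt (by nlinarith [sq_nonneg w'])
    rw [abs_mul, abs_of_pos hc] at this
    rw [one_div, inv_mul_eq_div, le_div_iff₀ hc]
    linarith
  have hwv : |w| = sfun p ^ ((3:ℝ)/2) * |v p| := by
    rw [hw, rayProfile, ray_self hs, abs_mul, abs_of_pos (Real.rpow_pos_of_pos hs _)]
  have hXle : X ≤ C₀ * (C₁ + 1) * (M' + I) := by
    calc X ≤ C₀ * (C₁ * M' + I) := henergy.trans (by gcongr)
      _ ≤ C₀ * ((C₁ + 1) * (M' + I)) := by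
        gcongr
        nlinarith [mul_nonneg hC₁pos.le hI]
      _ = _ := by ring
  have hV : Vfun s₀ η h v f p =
      (sfun p / p 0) ^ η * (M' + sfun p ^ ((1:ℝ)/2) * vone v p + I) := by
    rw [Vfun, hM']
    split_ifs <;> ring
  have hlhs : sfun p ^ ((3:ℝ)/2) * (|v p| + sfun p / p 0 * ⨆ α : Fin 4, |pd α v p|) ≤
      (1 / c + 1) * X + 6 * (sfun p ^ ((1:ℝ)/2) * vone v p) := by
    rw [mul_add, ← hwv]
    linarith
  rw [hV, mul_assoc, mul_left_comm ((1 / c + 1) * C₀ * (C₁ + 1) + 6)]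
  refine mul_le_mul_of_nonneg_left (hlhs.trans ?_) hθ.le
  have h1 : (1 / c + 1) * X ≤ (1 / c + 1) * (C₀ * (C₁ + 1) * (M' + I)) := by gcongr
  have h2 : 0 ≤ (1 / c + 1) * C₀ * (C₁ + 1) * (sfun p ^ ((1:ℝ)/2) * vone v p) := by positivity
  linarith
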